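/- arXiv:2208.09890 — 2 statements merged into one kernel-verified Lean document; each statement's English description precedes it below -/
import Mathlib

section
/- Let ℓ, ℓ' ≥ d be integers, let m ≥ 0, and let v, v' ∈ ℤ^{n+1} have degrees dm + ℓ and dm + ℓ' respectively. Assume D(v,ℓ) ⊆ D(v',ℓ'). Then for every G ∈ ℰ_{v',ℓ'}, the restriction G|_{D(v,ℓ)} lies in ℰ_{v,ℓ}. -/
noncomputable section

open MvPolynomial

/-- The finset `D_ℓ` of exponent vectors in `ℤ_{≥0}^{n+1}` of total degree `ℓ`,
realized as integer vectors. -/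
def Dfin (n ℓ : ℕ) : Finset (Fin (n + 1) → ℤ) :=
  (Finset.Nat.antidiagonalTuple (n + 1) ℓ).image fun t i => (t i : ℤ)

/-- The inverted simplex `D(v,ℓ) = {v - w : w ∈ D_ℓ}`. -/
def Dv {n : ℕ} (v : Fin (n + 1) → ℤ) (ℓ : ℕ) : Finset (Fin (n + 1) → ℤ) :=
  (Dfin n ℓ).image fun w => v - w

/-- The coefficient of a polynomial at an integer exponent vector (zero if some exponent
is negative). -/
def coeffZ {K : Type*} [Field K] {n : ℕ} (F : MvPolynomial (Fin (n + 1)) K)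
    (u : Fin (n + 1) → ℤ) : K :=
  if ∀ i, 0 ≤ u i then
    MvPolynomial.coeff (Finsupp.equivFunOnFinite.symm fun i => (u i).toNat) F
  else 0

/-- The linear functional
`G ↦ Σ_{t ∈ D_d} ((v_i - s_i) - (m+1)·t_i) · F_t · G_{v-s-t}`, i.e. the difference of the
two sides of the defining equation of `ℰ_{v,ℓ}` at `(s,i)`. -/
def eqFun {K : Type*} [Field K] {n : ℕ} (F : MvPolynomial (Fin (n + 1)) K) (d m : ℕ)
    (v s : Fin (n + 1) → ℤ) (i : Fin (n + 1)) : ((Fin (n + 1) → ℤ) →₀ K) →ₗ[K] K :=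
  ∑ t ∈ Dfin n d,
    ((((v i - s i : ℤ) : K) - ((m : K) + 1) * ((t i : ℤ) : K)) * coeffZ F t) •
      (Finsupp.lapply (v - s - t) : ((Fin (n + 1) → ℤ) →₀ K) →ₗ[K] K)

/-- The space `ℰ_{v,ℓ}`: Laurent polynomials `G` supported on `D(v,ℓ)` such that for every
`s ∈ D_{ℓ-d}` and every `i ∈ {0,…,n}`,
`(v_i - s_i) Σ_{t∈D_d} F_t G_{v-s-t} = (m+1) Σ_{t∈D_d} t_i F_t G_{v-s-t}`. -/
def Espace {K : Type*} [Field K] {n : ℕ} (F : MvPolynomial (Fin (n + 1)) K) (d m : ℕ)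
    (v : Fin (n + 1) → ℤ) (ℓ : ℕ) : Submodule K ((Fin (n + 1) → ℤ) →₀ K) :=
  Finsupp.supported K K ↑(Dv v ℓ) ⊓
    ⨅ s ∈ Dfin n (ℓ - d), ⨅ i : Fin (n + 1), LinearMap.ker (eqFun F d m v s i)

/-- Restriction `G|_S` of a Laurent polynomial to a finite set of monomials. -/
def restrictF {K : Type*} [Field K] {n : ℕ} (G : (Fin (n + 1) → ℤ) →₀ K)
    (S : Finset (Fin (n + 1) → ℤ)) : (Fin (n + 1) → ℤ) →₀ K :=
  ∑ u ∈ S, Finsupp.single u (G u)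

/-- Restriction `F|_S` of a polynomial to a finite set of (integer) monomials, as a Laurent
polynomial. -/
def restrictPoly {K : Type*} [Field K] {n : ℕ} (F : MvPolynomial (Fin (n + 1)) K)
    (S : Finset (Fin (n + 1) → ℤ)) : (Fin (n + 1) → ℤ) →₀ K :=
  ∑ u ∈ S, Finsupp.single u (coeffZ F u)

/-- The coefficient of the product `F·G` at the integer exponent vector `w`, where `F` is a
polynomial and `G` a Laurent polynomial. -/
def mulCoeffZ {K : Type*} [Field K] {n : ℕ} (F : MvPolynomial (Fin (n + 1)) K)
    (G : (Fin (n + 1) → ℤ) →₀ K) (w : Fin (n + 1) → ℤ) : K :=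
  ∑ t ∈ F.support, MvPolynomial.coeff t F * G fun i => w i - (t i : ℤ)

theorem mem_Dfin {n ℓ : ℕ} {w : Fin (n + 1) → ℤ} :
    w ∈ Dfin n ℓ ↔ (∀ i, 0 ≤ w i) ∧ ∑ i, w i = (ℓ : ℤ) := by
  simp only [Dfin, Finset.mem_image, Finset.Nat.mem_antidiagonalTuple]
  constructor
  · rintro ⟨t, ht, rfl⟩
    exact ⟨fun i => Int.natCast_nonneg _, by simp [← ht]⟩
  · rintro ⟨h0, hs⟩
    have key : (fun i => ((w i).toNat : ℤ)) = w := funext fun i => Int.toNat_of_nonneg (h0 i)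
    refine ⟨fun i => (w i).toNat, ?_, key⟩
    have h : ∑ i, ((w i).toNat : ℤ) = (ℓ : ℤ) := by
      rw [← hs]
      exact Finset.sum_congr rfl fun i _ => congrFun key i
    exact_mod_cast h

theorem mem_Dv {n ℓ : ℕ} {v u : Fin (n + 1) → ℤ} :
    u ∈ Dv v ℓ ↔ (∀ i, u i ≤ v i) ∧ ∑ i, v i - ∑ i, u i = (ℓ : ℤ) := by
  have h : u ∈ Dv v ℓ ↔ v - u ∈ Dfin n ℓ := by
    simp only [Dv, Finset.mem_image]
    constructor
    · rintro ⟨w, hw, rfl⟩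
      simpa using hw
    · exact fun hu => ⟨v - u, hu, by simp⟩
  rw [h, mem_Dfin]
  simp [Finset.sum_sub_distrib]

theorem le_of_Dv_subset {n ℓ ℓ' : ℕ} (hn : 1 ≤ n) {v v' : Fin (n + 1) → ℤ}
    (hsub : Dv v ℓ ⊆ Dv v' ℓ') (i : Fin (n + 1)) : v i ≤ v' i := by
  have : Nontrivial (Fin (n + 1)) := Fin.nontrivial_iff_two_le.2 (by lia)
  obtain ⟨j, hj⟩ := exists_ne i
  have hmem : v - Pi.single j (ℓ : ℤ) ∈ Dv v ℓ := by
    rw [mem_Dv]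
    refine ⟨fun k => ?_, by simp [Finset.sum_sub_distrib]⟩
    have : (0 : Fin (n + 1) → ℤ) ≤ Pi.single j (ℓ : ℤ) := Pi.single_nonneg.2 (by positivity)
    simpa using this k
  simpa [Pi.single_eq_of_ne hj.symm] using (mem_Dv.1 (hsub hmem)).1 i

theorem restrictF_apply {K : Type*} [Field K] {n : ℕ} (G : (Fin (n + 1) → ℤ) →₀ K)
    (S : Finset (Fin (n + 1) → ℤ)) (u : Fin (n + 1) → ℤ) :
    restrictF G S u = if u ∈ S then G u else 0 := by
  simp [restrictF, Finsupp.finsetSum_apply, Finsupp.single_apply]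

theorem eqFun_apply {K : Type*} [Field K] {n : ℕ} (F : MvPolynomial (Fin (n + 1)) K)
    (d m : ℕ) (v s : Fin (n + 1) → ℤ) (i : Fin (n + 1)) (G : (Fin (n + 1) → ℤ) →₀ K) :
    eqFun F d m v s i G = ∑ t ∈ Dfin n d,
      ((((v i - s i : ℤ) : K) - ((m : K) + 1) * ((t i : ℤ) : K)) * coeffZ F t) *
        G (v - s - t) := by
  simp [eqFun, LinearMap.sum_apply]

/-- Lemma 3.5: if `D(v,ℓ) ⊆ D(v',ℓ')` (with `deg v = dm + ℓ`, `deg v' = dm + ℓ'`,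
`ℓ, ℓ' ≥ d`), then restriction maps `ℰ_{v',ℓ'}` into `ℰ_{v,ℓ}`. -/
theorem restrict_Espace_mem {K : Type*} [Field K] (n : ℕ) (hn : 1 ≤ n)
    (d : ℕ) (hd : 2 ≤ d) (hdK : (d : K) ≠ 0)
    (F : MvPolynomial (Fin (n + 1)) K) (hF : F.IsHomogeneous d)
    (m ℓ ℓ' : ℕ) (hℓ : d ≤ ℓ) (hℓ' : d ≤ ℓ')
    (v v' : Fin (n + 1) → ℤ)
    (hv : (∑ i, v i) = ((d * m + ℓ : ℕ) : ℤ))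
    (hv' : (∑ i, v' i) = ((d * m + ℓ' : ℕ) : ℤ))
    (hsub : Dv v ℓ ⊆ Dv v' ℓ')
    (G : (Fin (n + 1) → ℤ) →₀ K) (hG : G ∈ Espace F d m v' ℓ') :
    restrictF G (Dv v ℓ) ∈ Espace F d m v ℓ := by
  have hle := le_of_Dv_subset hn hsub
  simp only [Espace, Submodule.mem_inf, Submodule.mem_iInf, LinearMap.mem_ker] at hG ⊢
  refine ⟨?_, fun s hs i => ?_⟩
  · rw [Finsupp.mem_supported']
    intro u hu
    rw [restrictF_apply, if_neg (by simpa using hu)]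
  obtain ⟨hs0, hsum⟩ := mem_Dfin.1 hs
  have hs' : v' - v + s ∈ Dfin n (ℓ' - d) := by
    refine mem_Dfin.2 ⟨fun k => ?_, ?_⟩
    · have h1 := hle k
      have h2 := hs0 k
      simp only [Pi.add_apply, Pi.sub_apply]
      linarith
    · simp only [Pi.add_apply, Pi.sub_apply, Finset.sum_add_distrib, Finset.sum_sub_distrib, hv,
        hv', hsum]
      push_cast [hℓ, hℓ']
      ring
  have hE := hG.2 _ hs' i
  rw [eqFun_apply] at hE ⊢
  rw [← hE]
  refine Finset.sum_congr rfl fun t ht => ?_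
  obtain ⟨ht0, htsum⟩ := mem_Dfin.1 ht
  have hmem : v - s - t ∈ Dv v ℓ := by
    refine mem_Dv.2 ⟨fun k => ?_, ?_⟩
    · have h1 := ht0 k
      have h2 := hs0 k
      simp only [Pi.sub_apply]
      linarith
    · simp only [Pi.sub_apply, Finset.sum_sub_distrib, hsum, htsum]
      push_cast [hℓ]
      ring
  have hshift : v' - (v' - v + s) = v - s := by abel
  have hshift_i : v' i - (v' - v + s) i = v i - s i := congrFun hshift i
  rw [restrictF_apply, if_pos hmem, hshift, hshift_i]
end
end

section
/- Let ℓ ≥ d, m ≥ 0, and v ∈ ℤ^{n+1} of degree dm + ℓ. Let u ∈ D_ℓ, and suppose λ ∈ K, homogeneous polynomials h_0, …, h_n ∈ K[x]_{ℓ−d}, a finite subset B ⊆ D_ℓ, and scalars c_β ∈ K (β ∈ B) satisfy λ x^u = Σ_{i=0}^n h_i ∂_iF + Σ_{β∈B} c_β x^β. Then every G ∈ ℰ_{v,ℓ} satisfies (m+1) λ G_{v−u} = Σ_{i=0}^n Σ_{s∈D_{ℓ−d}} (v_i − s_i) (h_i)_s (FG)_{v−s} + (m+1) Σ_{β∈B}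 c_β G_{v−β}, where (FG)_{v−s} denotes the coefficient of x^{v−s} in the product F·G and (h_i)_s the coefficient of x^s in h_i. -/
noncomputable section

open MvPolynomial

section LaurentCoefficient

variable {K : Type*} [Field K] {n : ℕ}

/-- The coefficient of `F·G` at the Laurent exponent `w`, as a linear functional of the
polynomial `F`. -/
def laurentCoeff (G : (Fin (n + 1) → ℤ) →₀ K) (w : Fin (n + 1) → ℤ) :
    MvPolynomial (Fin (n + 1)) K →ₗ[K] K :=
  (MvPolynomial.basisMonomials (Fin (n + 1)) K).constr K
    fun t => G fun i => w i - (t i : ℤ)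

theorem laurentCoeff_monomial (G : (Fin (n + 1) → ℤ) →₀ K) (w : Fin (n + 1) → ℤ)
    (t : Fin (n + 1) →₀ ℕ) (a : K) :
    laurentCoeff G w (monomial t a) = a * G fun i => w i - (t i : ℤ) := by
  have key : laurentCoeff G w (monomial t 1) = G fun i => w i - (t i : ℤ) := by
    have := (MvPolynomial.basisMonomials (Fin (n + 1)) K).constr_basis K
      (fun t : Fin (n + 1) →₀ ℕ => G fun i => w i - (t i : ℤ)) t
    rwa [MvPolynomial.coe_basisMonomials] at this
  rw [← mul_one a, ← smul_eq_mul, ← smul_monomial, map_smul, key]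
  simp

theorem laurentCoeff_eq_mulCoeffZ (G : (Fin (n + 1) → ℤ) →₀ K) (w : Fin (n + 1) → ℤ)
    (F : MvPolynomial (Fin (n + 1)) K) : laurentCoeff G w F = mulCoeffZ F G w := by
  conv_lhs => rw [F.as_sum]
  simp only [map_sum, laurentCoeff_monomial, mulCoeffZ]

theorem laurentCoeff_monomial_mul (G : (Fin (n + 1) → ℤ) →₀ K) (w : Fin (n + 1) → ℤ)
    (s : Fin (n + 1) →₀ ℕ) (a : K) (Q : MvPolynomial (Fin (n + 1)) K) :
    laurentCoeff G w (monomial s a * Q)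
      = a * laurentCoeff G (w - fun i => (s i : ℤ)) Q := by
  induction Q using MvPolynomial.induction_on' with
  | monomial t b =>
    simp only [monomial_mul, laurentCoeff_monomial, mul_assoc, Finsupp.add_apply, Nat.cast_add,
      Pi.sub_apply, sub_sub]
  | add p q hp hq => simp only [mul_add, map_add, hp, hq]

theorem coeffZ_natCast (F : MvPolynomial (Fin (n + 1)) K) (t : Fin (n + 1) → ℕ) :
    coeffZ F (fun i => (t i : ℤ)) = coeff (Finsupp.equivFunOnFinite.symm t) F := by
  simp [coeffZ]

theorem sum_Dfin {M : Type*} [AddCommMonoid M] (k : ℕ) (f : (Fin (n + 1) → ℤ) → M) :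
    ∑ s ∈ Dfin n k, f s
      = ∑ t ∈ Finset.Nat.antidiagonalTuple (n + 1) k, f fun i => (t i : ℤ) := by
  refine Finset.sum_image fun a _ b _ hab => ?_
  funext i
  exact_mod_cast congrFun hab i

theorem MvPolynomial.IsHomogeneous.eq_sum_antidiagonalTuple {k : ℕ}
    {p : MvPolynomial (Fin (n + 1)) K} (hp : p.IsHomogeneous k) :
    p = ∑ t ∈ Finset.Nat.antidiagonalTuple (n + 1) k,
      monomial (Finsupp.equivFunOnFinite.symm t)
        (coeff (Finsupp.equivFunOnFinite.symm t) p) := by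
  classical
  ext e
  simp only [coeff_sum, coeff_monomial]
  by_cases he : coeff e p = 0
  · rw [he]
    refine (Finset.sum_eq_zero fun t _ => ?_).symm
    split_ifs with hte
    · rw [hte, he]
    · rfl
  · rw [Finset.sum_eq_single (e : Fin (n + 1) → ℕ)]
    · simp
    · intro t _ hne
      refine if_neg fun hte => hne ?_
      rw [← hte]
      rfl
    · intro hnot
      refine absurd (Finset.Nat.mem_antidiagonalTuple.2 ?_) hnot
      rw [← Finsupp.degree_eq_sum]
      by_contra hdeg
      exact he (hp.coeff_eq_zero hdeg)

theorem MvPolynomial.IsHomogeneous.laurentCoeff_mul {k : ℕ}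
    {p : MvPolynomial (Fin (n + 1)) K} (hp : p.IsHomogeneous k)
    (Q : MvPolynomial (Fin (n + 1)) K) (G : (Fin (n + 1) → ℤ) →₀ K)
    (w : Fin (n + 1) → ℤ) :
    laurentCoeff G w (p * Q) = ∑ s ∈ Dfin n k, coeffZ p s * laurentCoeff G (w - s) Q := by
  conv_lhs => rw [hp.eq_sum_antidiagonalTuple]
  rw [sum_Dfin, Finset.sum_mul, map_sum]
  simp only [laurentCoeff_monomial_mul, coeffZ_natCast]
  rfl

theorem MvPolynomial.IsHomogeneous.laurentCoeff_eq_sum {k : ℕ}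
    {p : MvPolynomial (Fin (n + 1)) K} (hp : p.IsHomogeneous k)
    (G : (Fin (n + 1) → ℤ) →₀ K) (w : Fin (n + 1) → ℤ) :
    laurentCoeff G w p = ∑ t ∈ Dfin n k, coeffZ p t * G (w - t) := by
  have hone : ∀ z, laurentCoeff G z 1 = G z := fun z => by
    rw [← C_1, C_apply, laurentCoeff_monomial]
    simp
  simpa only [mul_one, hone] using hp.laurentCoeff_mul 1 G w

theorem laurentCoeff_X_mul_pderiv {k : ℕ} {F : MvPolynomial (Fin (n + 1)) K}
    (hF : F.IsHomogeneous k) (G : (Fin (n + 1) → ℤ) →₀ K) (w : Fin (n + 1) → ℤ)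
    (i : Fin (n + 1)) :
    laurentCoeff G w (X i * pderiv i F)
      = ∑ t ∈ Dfin n k, ((t i : ℤ) : K) * (coeffZ F t * G (w - t)) := by
  conv_lhs => rw [hF.eq_sum_antidiagonalTuple]
  rw [sum_Dfin, map_sum, Finset.mul_sum, map_sum]
  refine Finset.sum_congr rfl fun t _ => ?_
  rw [X_mul_pderiv_monomial, map_nsmul, laurentCoeff_monomial, coeffZ_natCast, nsmul_eq_mul,
    Int.cast_natCast]
  rfl

/-- The defining equations of `ℰ_{v,ℓ}`, as a relation between the coefficients of `F·G` and
of `∂_i F·G`. -/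
theorem mul_laurentCoeff_of_mem_Espace {d m ℓ : ℕ} {F : MvPolynomial (Fin (n + 1)) K}
    (hF : F.IsHomogeneous d) {v : Fin (n + 1) → ℤ} {G : (Fin (n + 1) → ℤ) →₀ K}
    (hG : G ∈ Espace F d m v ℓ) {s : Fin (n + 1) → ℤ} (hs : s ∈ Dfin n (ℓ - d))
    (i : Fin (n + 1)) :
    ((m : K) + 1) * laurentCoeff G (v - s) (X i * pderiv i F)
      = ((v i - s i : ℤ) : K) * laurentCoeff G (v - s) F := by
  have hker : eqFun F d m v s i G = 0 := by
    have := hG.2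
    simp only [Submodule.mem_iInf, LinearMap.mem_ker, SetLike.mem_coe] at this
    exact this s hs i
  rw [laurentCoeff_X_mul_pderiv hF, hF.laurentCoeff_eq_sum, eq_comm, ← sub_eq_zero, ← hker,
    eqFun, Finset.mul_sum, Finset.mul_sum, ← Finset.sum_sub_distrib, LinearMap.sum_apply]
  refine Finset.sum_congr rfl fun t _ => ?_
  simp only [LinearMap.smul_apply, Finsupp.lapply_apply, smul_eq_mul]
  ring

end LaurentCoefficient

/-- The key identity in the proof of Lemma 3.7: if
`λ x^u = Σ_i h_i ∂_iF + Σ_{β∈B} c_β x^β` with `u ∈ D_ℓ`, `h_i ∈ K[x]_{ℓ-d}`, `B ⊆ D_ℓ`,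
then every `G ∈ ℰ_{v,ℓ}` satisfies
`(m+1) λ G_{v-u} = Σ_i Σ_{s∈D_{ℓ-d}} (v_i - s_i)(h_i)_s (FG)_{v-s}
  + (m+1) Σ_{β∈B} c_β G_{v-β}`. -/
theorem compression_coefficient_identity {K : Type*} [Field K] (n : ℕ) (hn : 1 ≤ n)
    (d : ℕ) (hd : 2 ≤ d) (hdK : (d : K) ≠ 0)
    (F : MvPolynomial (Fin (n + 1)) K) (hF : F.IsHomogeneous d)
    (m ℓ : ℕ) (hℓ : d ≤ ℓ) (v : Fin (n + 1) → ℤ)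
    (hv : (∑ i, v i) = ((d * m + ℓ : ℕ) : ℤ))
    (u : Fin (n + 1) → ℕ) (hu : u ∈ Finset.Nat.antidiagonalTuple (n + 1) ℓ)
    (lam : K)
    (h : Fin (n + 1) → MvPolynomial (Fin (n + 1)) K)
    (hh : ∀ i, (h i).IsHomogeneous (ℓ - d))
    (B : Finset (Fin (n + 1) → ℕ)) (hB : B ⊆ Finset.Nat.antidiagonalTuple (n + 1) ℓ)
    (c : (Fin (n + 1) → ℕ) → K)
    (hrel : (MvPolynomial.monomial (Finsupp.equivFunOnFinite.symm u) lam
        : MvPolynomial (Fin (n + 1)) K)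
      = (∑ i, h i * (X i * pderiv i F))
        + ∑ β ∈ B, MvPolynomial.monomial (Finsupp.equivFunOnFinite.symm β) (c β))
    (G : (Fin (n + 1) → ℤ) →₀ K) (hG : G ∈ Espace F d m v ℓ) :
    ((m : K) + 1) * lam * G (fun i => v i - (u i : ℤ))
      = (∑ i, ∑ s ∈ Dfin n (ℓ - d),
          ((v i - s i : ℤ) : K) * coeffZ (h i) s * mulCoeffZ F G (v - s))
        + ((m : K) + 1) * ∑ β ∈ B, c β * G (fun i => v i - (β i : ℤ)) := by
  have hL := congrArg (fun p => ((m : K) + 1) * laurentCoeff G v p) hrel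
  simp only [map_add, map_sum, laurentCoeff_monomial, Finsupp.coe_equivFunOnFinite_symm] at hL
  rw [mul_assoc, hL, mul_add, Finset.mul_sum]
  congr 1
  refine Finset.sum_congr rfl fun i _ => ?_
  rw [(hh i).laurentCoeff_mul, Finset.mul_sum]
  refine Finset.sum_congr rfl fun s hs => ?_
  rw [mul_left_comm, mul_laurentCoeff_of_mem_Espace hF hG hs i, laurentCoeff_eq_mulCoeffZ]
  ring
end
end
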